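/- For every j = (j₁,j₂) ∈ ℤ² with β_{j₁} ≠ j₂π/c̃ and β_{j₁} ≠ −j₂π/c̃, the Fourier coefficient of K satisfies K̂_j = (1/(2√(π c̃))) · [ 1/((α+j₁)² + (j₂π/c̃)² − k²) + (1/(2β_{j₁}(j₂π/c̃ − β_{j₁}))) ∫₀^{c̃} e^{iβ_{j₁} t} 𝒳′(t) e^{−i(j₂π/c̃)t} dt − (1/(2β_{j₁}(j₂π/c̃ + β_{j₁}))) ∫₀^{c̃} e^{iβ_{j₁} t} 𝒳′(t) e^{i(j₂π/c̃)t} dt ]. -/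

import Mathlib

open MeasureTheory Complex Real

noncomputable section

def betaCoef (k α : ℝ) (n : ℤ) : ℂ :=
  if |α + (n : ℝ)| ≤ k then ((Real.sqrt (k ^ 2 - (α + (n : ℝ)) ^ 2) : ℝ) : ℂ)
  else Complex.I * ((Real.sqrt ((α + (n : ℝ)) ^ 2 - k ^ 2) : ℝ) : ℂ)

/-- The α-quasi-periodic Green's function (eigenfunction expansion). -/
def greenG (k α : ℝ) (x : EuclideanSpace ℝ (Fin 2)) : ℂ :=
  (Complex.I / (4 * (π : ℂ))) *
    ∑' n : ℤ, (1 / betaCoef k α n) *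
      Complex.exp (Complex.I * ((α + (n : ℝ) : ℝ) : ℂ) * (x 0 : ℂ) +
        Complex.I * betaCoef k α n * ((|x 1| : ℝ) : ℂ))

/-- K(x) = e^{−iαx₁} G(x) 𝒳(|x₂|). -/
def funK (k α : ℝ) (𝒳 : ℝ → ℝ) (x : EuclideanSpace ℝ (Fin 2)) : ℂ :=
  Complex.exp (-Complex.I * (α : ℂ) * (x 0 : ℂ)) * greenG k α x * ((𝒳 |x 1| : ℝ) : ℂ)

/-- The rectangle D_c̃ = [−π,π] × [−c̃,c̃]. -/
def domD (ct : ℝ) : Set (EuclideanSpace ℝ (Fin 2)) :=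
  {x | x 0 ∈ Set.Icc (-π) π ∧ x 1 ∈ Set.Icc (-ct) ct}

/-- The Fourier basis φ_j(x) = (1/(2√(π c̃))) e^{i(j₁x₁ + j₂πx₂/c̃)}. -/
def fBasis (ct : ℝ) (j : ℤ × ℤ) (x : EuclideanSpace ℝ (Fin 2)) : ℂ :=
  (1 / (2 * Real.sqrt (π * ct)) : ℝ) *
    Complex.exp (Complex.I * ((j.1 : ℂ) * (x 0 : ℂ) + (j.2 : ℂ) * (π : ℂ) * (x 1 : ℂ) / (ct : ℂ)))

/-- The j-th Fourier coefficient ĝ_j = ∫_{D_c̃} g(x) φ_{−j}(x) dx. -/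
def fourierCoef (ct : ℝ) (g : EuclideanSpace ℝ (Fin 2) → ℂ) (j : ℤ × ℤ) : ℂ :=
  ∫ x in domD ct, g x * fBasis ct (-j) x

lemma betaCoef_sq {k : ℝ} (hk : 0 ≤ k) (α : ℝ) (n : ℤ) :
    betaCoef k α n ^ 2 = ((k ^ 2 - (α + n) ^ 2 : ℝ) : ℂ) := by
  unfold betaCoef
  split_ifs with h
  · rw [← Complex.ofReal_pow, Real.sq_sqrt]
    have := sq_le_sq.mpr (h.trans (le_abs_self k))
    linarith
  · rw [mul_pow, I_sq, ← Complex.ofReal_pow, Real.sq_sqrt]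
    · push_cast; ring
    · have := sq_le_sq.mpr ((abs_of_nonneg hk).le.trans (not_le.mp h).le)
      linarith

lemma betaCoef_im_eq_norm {k α : ℝ} {n : ℤ} (h : k < |α + n|) :
    (betaCoef k α n).im = ‖betaCoef k α n‖ := by
  simp [betaCoef, not_le.mpr h, abs_of_nonneg (Real.sqrt_nonneg _)]

lemma eventually_lt_abs_add_intCast (α R : ℝ) : ∀ᶠ n : ℤ in Filter.cofinite, R < |α + n| := by
  have h : Filter.Tendsto (fun n : ℤ => ‖(n : ℝ)‖) Filter.cofinite Filter.atTop :=
    tendsto_norm_cocompact_atTop.comp Int.tendsto_coe_cofinite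
  filter_upwards [h.eventually_gt_atTop (R + |α|)] with n hn
  rw [Real.norm_eq_abs] at hn
  have := abs_sub_abs_le_abs_sub (n : ℝ) (-α)
  rw [abs_neg, sub_neg_eq_add, add_comm (n : ℝ)] at this
  linarith

lemma summable_one_div_norm_betaCoef_sq {k : ℝ} (hk : 0 < k) (α : ℝ) :
    Summable fun n : ℤ => 1 / ‖betaCoef k α n‖ ^ 2 := by
  have hs : Summable fun n : ℤ => 2 * (1 / |(n : ℝ) + α| ^ (2 : ℝ)) :=
    ((Real.summable_one_div_int_add_rpow α 2).mpr one_lt_two).mul_left 2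
  refine hs.of_norm_bounded_eventually ?_
  filter_upwards [eventually_lt_abs_add_intCast α (2 * k)] with n hn
  have hsq : (2 * k) ^ 2 < (α + n) ^ 2 := by
    rw [← sq_abs (α + n)]
    gcongr
  rw [Real.norm_of_nonneg (by positivity), ← norm_pow, betaCoef_sq hk.le, Complex.norm_real,
    Real.norm_eq_abs, abs_of_neg (by nlinarith), Real.rpow_two, sq_abs, add_comm (n : ℝ),
    mul_one_div, div_le_div_iff₀ (by nlinarith) (by nlinarith)]
  nlinarith

lemma integral_domD (ct : ℝ) (F : ℝ → ℝ → ℂ) :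
    ∫ x in domD ct, F (x 0) (x 1) =
      ∫ p, F p.1 p.2 ∂((volume.restrict (Set.Icc (-π) π)).prod
        (volume.restrict (Set.Icc (-ct) ct))) := by
  let e := (MeasurableEquiv.toLp 2 (Fin 2 → ℝ)).symm.trans MeasurableEquiv.finTwoArrow
  have he : MeasurePreserving e volume volume :=
    (volume_preserving_finTwoArrow ℝ).comp
      (EuclideanSpace.volume_preserving_symm_measurableEquiv_toLp (Fin 2))
  rw [Measure.prod_restrict, ← Measure.volume_eq_prod]
  exact he.setIntegral_preimage_emb e.measurableEmbedding (fun p => F p.1 p.2)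
    (Set.Icc (-π) π ×ˢ Set.Icc (-ct) ct)

lemma integral_exp_int_mul (m : ℤ) :
    ∫ x in Set.Icc (-π) π, Complex.exp (I * m * x) = if m = 0 then 2 * (π : ℂ) else 0 := by
  rw [integral_Icc_eq_integral_Ioc, ← intervalIntegral.integral_of_le (by linarith [pi_pos])]
  split_ifs with h
  · simp [h, two_mul]
  · rw [integral_exp_mul_complex (mul_ne_zero I_ne_zero (Int.cast_ne_zero.mpr h)),
      Complex.exp_eq_exp_iff_exists_int.mpr ⟨m, ?_⟩, sub_self, zero_div]
    push_cast
    ring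

lemma integral_Icc_neg_self_eq {E : Type*} [NormedAddCommGroup E] [NormedSpace ℝ E] {a : ℝ}
    (ha : 0 ≤ a) {f : ℝ → E} (hf : Continuous f) :
    ∫ y in Set.Icc (-a) a, f y = ∫ y in (0 : ℝ)..a, (f y + f (-y)) := by
  rw [integral_Icc_eq_integral_Ioc, ← intervalIntegral.integral_of_le (by linarith),
    ← intervalIntegral.integral_add_adjacent_intervals (b := 0) (hf.intervalIntegrable _ _)
      (hf.intervalIntegrable _ _),
    intervalIntegral.integral_add (hf.intervalIntegrable _ _)
      ((by fun_prop : Continuous fun y => f (-y)).intervalIntegrable _ _),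
    intervalIntegral.integral_comp_neg, neg_zero, add_comm]

lemma integral_exp_neg_mul_le {b a : ℝ} (hb : 0 < b) :
    ∫ y in (0 : ℝ)..a, Real.exp (-b * y) ≤ 1 / b := by
  rw [intervalIntegral.integral_comp_mul_left (fun x => Real.exp x) (neg_ne_zero.mpr hb.ne'),
    integral_exp, mul_zero, Real.exp_zero, smul_eq_mul, inv_neg, one_div]
  nlinarith [Real.exp_pos (-b * a), inv_pos.mpr hb]

lemma integral_exp_mul_cutoff {ct : ℝ} {𝒳 : ℝ → ℝ} (h𝒳 : ContDiff ℝ 1 𝒳) (h0 : 𝒳 0 = 1)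
    (hct : 𝒳 ct = 0) {μ : ℂ} (hμ : μ ≠ 0) :
    ∫ t in (0 : ℝ)..ct, Complex.exp (I * μ * t) * (𝒳 t : ℂ) =
      I / μ * (1 + ∫ t in (0 : ℝ)..ct, Complex.exp (I * μ * t) * ((deriv 𝒳 t : ℝ) : ℂ)) := by
  have hIμ : I * μ ≠ 0 := mul_ne_zero I_ne_zero hμ
  have hu (x : ℝ) : HasDerivAt (fun t : ℝ => (𝒳 t : ℂ)) ((deriv 𝒳 x : ℝ) : ℂ) x :=
    (h𝒳.differentiable one_ne_zero x).hasDerivAt.ofReal_comp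
  have hv (x : ℝ) : HasDerivAt (fun t : ℝ => Complex.exp (I * μ * t) / (I * μ))
      (Complex.exp (I * μ * x)) x := by
    have := (((hasDerivAt_id x).ofReal_comp.const_mul (I * μ)).cexp).div_const (I * μ)
    simpa [hIμ] using this
  have hdc : Continuous fun t : ℝ => ((deriv 𝒳 t : ℝ) : ℂ) :=
    continuous_ofReal.comp (h𝒳.continuous_deriv le_rfl)
  have h := intervalIntegral.integral_mul_deriv_eq_deriv_mul (a := 0) (b := ct)
    (fun x _ => hu x) (fun x _ => hv x) (hdc.intervalIntegrable _ _)
    ((by fun_prop : Continuous fun t : ℝ => Complex.exp (I * μ * t)).intervalIntegrable _ _)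
  have h' : ∫ t in (0 : ℝ)..ct, ((deriv 𝒳 t : ℝ) : ℂ) * (Complex.exp (I * μ * t) / (I * μ)) =
      (∫ t in (0 : ℝ)..ct, Complex.exp (I * μ * t) * ((deriv 𝒳 t : ℝ) : ℂ)) / (I * μ) := by
    rw [← intervalIntegral.integral_div]
    congr 1 with t
    ring
  simp_rw [mul_comm _ ((𝒳 _ : ℝ) : ℂ)]
  rw [h, h', h0, hct]
  field_simp
  simp
  ring

/-- The vertical factor of the `n`-th mode of `K φ_{-j}`, where `q = j₂ π / c̃`. -/
def modeFactor (k α : ℝ) (𝒳 : ℝ → ℝ) (q : ℂ) (n : ℤ) (y : ℝ) : ℂ :=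
  Complex.exp (I * betaCoef k α n * (|y| : ℝ)) * (𝒳 |y| : ℂ) * Complex.exp (-I * q * y)

lemma continuous_modeFactor (k α : ℝ) {𝒳 : ℝ → ℝ} (h𝒳 : Continuous 𝒳) (q : ℂ) (n : ℤ) :
    Continuous (modeFactor k α 𝒳 q n) := by
  unfold modeFactor
  fun_prop

lemma norm_modeFactor (k α : ℝ) (𝒳 : ℝ → ℝ) (q : ℝ) (n : ℤ) (y : ℝ) :
    ‖modeFactor k α 𝒳 q n y‖ = Real.exp (-(betaCoef k α n).im * |y|) * |(𝒳 |y|)| := by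
  have h : ‖Complex.exp (-I * q * y)‖ = 1 := by simp [Complex.norm_exp]
  rw [modeFactor, norm_mul, h, mul_one, norm_mul, Complex.norm_real, Real.norm_eq_abs,
    Complex.norm_exp]
  simp

lemma exists_integral_norm_modeFactor_le {k : ℝ} (hk : 0 < k) (α : ℝ) {ct : ℝ} (hct : 0 ≤ ct)
    {𝒳 : ℝ → ℝ} (h𝒳 : Continuous 𝒳) (q : ℝ) :
    ∃ M, ∀ᶠ n : ℤ in Filter.cofinite,
      ∫ y in Set.Icc (-ct) ct, ‖modeFactor k α 𝒳 q n y‖ ≤ M / ‖betaCoef k α n‖ := by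
  obtain ⟨M, hM⟩ := isCompact_Icc.exists_bound_of_continuousOn (s := Set.Icc 0 ct)
    h𝒳.continuousOn
  have hM0 : 0 ≤ M := (norm_nonneg _).trans (hM 0 ⟨le_rfl, hct⟩)
  refine ⟨2 * M, ?_⟩
  filter_upwards [eventually_lt_abs_add_intCast α k] with n hn
  have hb : 0 < ‖betaCoef k α n‖ := by
    have h := betaCoef_sq hk.le α n
    refine norm_pos_iff.mpr fun h0 => ?_
    rw [h0, zero_pow two_ne_zero, eq_comm, Complex.ofReal_eq_zero, ← sq_abs (α + n)] at h
    nlinarith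
  have hc := (continuous_modeFactor k α h𝒳 q n).norm
  rw [integral_Icc_neg_self_eq hct hc]
  calc _ ≤ ∫ y in (0 : ℝ)..ct, 2 * M * Real.exp (-‖betaCoef k α n‖ * y) := by
        refine intervalIntegral.integral_mono_on hct
          ((hc.add (hc.comp continuous_neg)).intervalIntegrable _ _)
          ((by fun_prop : Continuous _).intervalIntegrable _ _) fun y hy => ?_
        have := mul_le_mul_of_nonneg_left (hM y hy)
          (Real.exp_nonneg (-‖betaCoef k α n‖ * y))
        rw [norm_modeFactor, norm_modeFactor, abs_neg, abs_of_nonneg hy.1, betaCoef_im_eq_norm hn]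
        rw [Real.norm_eq_abs] at this
        linarith
    _ ≤ 2 * M * (1 / ‖betaCoef k α n‖) := by
        rw [intervalIntegral.integral_const_mul]
        exact mul_le_mul_of_nonneg_left (integral_exp_neg_mul_le hb) (by positivity)
    _ = _ := by ring

lemma integral_modeFactor {ct : ℝ} (hct : 0 ≤ ct) (k α : ℝ) {𝒳 : ℝ → ℝ} (h𝒳 : Continuous 𝒳)
    (q : ℂ) (n : ℤ) :
    ∫ y in Set.Icc (-ct) ct, modeFactor k α 𝒳 q n y =
      (∫ t in (0 : ℝ)..ct, Complex.exp (I * (betaCoef k α n - q) * t) * (𝒳 t : ℂ)) +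
        ∫ t in (0 : ℝ)..ct, Complex.exp (I * (betaCoef k α n + q) * t) * (𝒳 t : ℂ) := by
  rw [integral_Icc_neg_self_eq hct (continuous_modeFactor k α h𝒳 q n),
    ← intervalIntegral.integral_add
      ((by fun_prop : Continuous _).intervalIntegrable _ _)
      ((by fun_prop : Continuous _).intervalIntegrable _ _)]
  refine intervalIntegral.integral_congr fun t ht => ?_
  rw [Set.uIcc_of_le hct] at ht
  simp only [modeFactor, abs_neg, abs_of_nonneg ht.1]
  rw [mul_right_comm, ← Complex.exp_add,
    mul_right_comm _ (𝒳 t : ℂ) (Complex.exp (_ * _ * (-t : ℝ))),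
    ← Complex.exp_add]
  push_cast
  ring_nf

lemma funK_mul_fBasis_neg (k α ct : ℝ) (𝒳 : ℝ → ℝ) (j : ℤ × ℤ) (x : EuclideanSpace ℝ (Fin 2)) :
    funK k α 𝒳 x * fBasis ct (-j) x =
      I / (8 * π * Real.sqrt (π * ct)) * ∑' n : ℤ, Complex.exp (I * (n - j.1 : ℤ) * x 0) *
        (1 / betaCoef k α n * modeFactor k α 𝒳 (j.2 * π / ct : ℝ) n (x 1)) := by
  have hterm (n : ℤ) : Complex.exp (I * (n - j.1 : ℤ) * x 0) *
        (1 / betaCoef k α n * modeFactor k α 𝒳 (j.2 * π / ct : ℝ) n (x 1)) =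
      (Complex.exp (-I * α * x 0) * (𝒳 |x 1| : ℂ) *
        Complex.exp (I * (((-j).1 : ℂ) * x 0 + ((-j).2 : ℂ) * π * x 1 / ct))) *
      ((1 / betaCoef k α n) * Complex.exp (I * ((α + n : ℝ) : ℂ) * x 0 +
        I * betaCoef k α n * ((|x 1| : ℝ) : ℂ))) := by
    have hexp : Complex.exp (I * (n - j.1 : ℤ) * x 0) *
        Complex.exp (I * betaCoef k α n * (|x 1| : ℝ)) *
          Complex.exp (-I * (j.2 * π / ct : ℝ) * x 1) =
        Complex.exp (-I * α * x 0) *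
        Complex.exp (I * (((-j).1 : ℂ) * x 0 + ((-j).2 : ℂ) * π * x 1 / ct)) *
        Complex.exp (I * ((α + n : ℝ) : ℂ) * x 0 + I * betaCoef k α n * ((|x 1| : ℝ) : ℂ)) := by
      simp only [← Complex.exp_add]
      congr 1
      push_cast [Prod.fst_neg, Prod.snd_neg]
      ring
    rw [modeFactor]
    linear_combination (1 / betaCoef k α n * (𝒳 |x 1| : ℂ)) * hexp
  simp_rw [hterm]
  rw [tsum_mul_left, funK, greenG, fBasis]
  push_cast
  ring

/-- Only the mode `n = j₁` contributes to the `j`-th Fourier coefficient of `K`. -/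
lemma fourierCoef_funK {k : ℝ} (hk : 0 < k) (α : ℝ) {ct : ℝ} (hct : 0 ≤ ct) {𝒳 : ℝ → ℝ}
    (h𝒳 : Continuous 𝒳) (j : ℤ × ℤ) :
    fourierCoef ct (funK k α 𝒳) j =
      I / (4 * Real.sqrt (π * ct) * betaCoef k α j.1) *
        ∫ y in Set.Icc (-ct) ct, modeFactor k α 𝒳 (j.2 * π / ct : ℝ) j.1 y := by
  set q : ℝ := j.2 * π / ct
  let F : ℤ → ℝ × ℝ → ℂ := fun n p => Complex.exp (I * (n - j.1 : ℤ) * p.1) *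
    (1 / betaCoef k α n * modeFactor k α 𝒳 q n p.2)
  let μ := (volume.restrict (Set.Icc (-π) π)).prod (volume.restrict (Set.Icc (-ct) ct))
  have hexp (n : ℤ) : Continuous fun x : ℝ => Complex.exp (I * (n - j.1 : ℤ) * x) := by fun_prop
  have hmode (n : ℤ) : Continuous fun y : ℝ => 1 / betaCoef k α n * modeFactor k α 𝒳 q n y :=
    (continuous_modeFactor k α h𝒳 q n).const_mul _
  have hFint (n : ℤ) : Integrable (F n) μ :=
    Integrable.mul_prod ((hexp n).integrableOn_Icc) ((hmode n).integrableOn_Icc)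
  have hFnorm (n : ℤ) : ∫ p, ‖F n p‖ ∂μ = 2 * π * (1 / ‖betaCoef k α n‖ *
      ∫ y in Set.Icc (-ct) ct, ‖modeFactor k α 𝒳 q n y‖) := by
    simp only [F, norm_mul]
    rw [integral_prod_mul (fun x : ℝ => ‖Complex.exp (I * (n - j.1 : ℤ) * x)‖)
      (fun y => ‖1 / betaCoef k α n‖ * ‖modeFactor k α 𝒳 q n y‖), integral_const_mul]
    congr 1
    · have (x : ℝ) : ‖Complex.exp (I * (n - j.1 : ℤ) * x)‖ = 1 := by simp [Complex.norm_exp]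
      simp_rw [this]
      simp [pi_pos.le, two_mul]
    · simp
  have hFsum : Summable fun n => ∫ p, ‖F n p‖ ∂μ := by
    obtain ⟨M, hM⟩ := exists_integral_norm_modeFactor_le hk α hct h𝒳 q
    simp_rw [hFnorm]
    refine Summable.mul_left _ (((summable_one_div_norm_betaCoef_sq hk α).mul_left
      M).of_norm_bounded_eventually ?_)
    filter_upwards [hM] with n hn
    rw [Real.norm_of_nonneg
      (mul_nonneg (by positivity) (integral_nonneg fun _ => norm_nonneg _))]
    calc _ ≤ 1 / ‖betaCoef k α n‖ * (M / ‖betaCoef k α n‖) := by gcongr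
      _ = _ := by ring
  have hFval (n : ℤ) : ∫ p, F n p ∂μ = if n = j.1 then 2 * π * (1 / betaCoef k α j.1 *
      ∫ y in Set.Icc (-ct) ct, modeFactor k α 𝒳 q j.1 y) else 0 := by
    simp only [F]
    rw [integral_prod_mul (fun x : ℝ => Complex.exp (I * (n - j.1 : ℤ) * x))
      (fun y => 1 / betaCoef k α n * modeFactor k α 𝒳 q n y),
      integral_exp_int_mul, integral_const_mul]
    by_cases h : n = j.1
    · simp [h]
    · simp [h, sub_eq_zero]
  rw [fourierCoef]
  simp_rw [funK_mul_fBasis_neg]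
  rw [integral_const_mul, integral_domD ct fun a b => ∑' n : ℤ,
      Complex.exp (I * (n - j.1 : ℤ) * a) * (1 / betaCoef k α n * modeFactor k α 𝒳 q n b)]
  have htsum := integral_tsum_of_summable_integral_norm hFint hFsum
  simp_rw [hFval, tsum_ite_eq] at htsum
  rw [← htsum]
  have : (π : ℂ) ≠ 0 := ofReal_ne_zero.mpr pi_ne_zero
  field_simp
  ring

/-- If β_{j₁} ≠ ±j₂π/c̃ then
K̂_j = (1/(2√(πc̃))) [1/((α+j₁)²+(j₂π/c̃)²−k²)
 + (1/(2β_{j₁}(j₂π/c̃−β_{j₁}))) ∫₀^{c̃} e^{iβ_{j₁}t}𝒳′(t)e^{−i(j₂π/c̃)t}dt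
 − (1/(2β_{j₁}(j₂π/c̃+β_{j₁}))) ∫₀^{c̃} e^{iβ_{j₁}t}𝒳′(t)e^{i(j₂π/c̃)t}dt]. -/
theorem statement3 (k α c ct : ℝ) (hk : 0 < k) (hc : 0 < c) (hcct : c < ct)
    (hβ : ∀ n : ℤ, betaCoef k α n ≠ 0)
    (𝒳 : ℝ → ℝ) (h𝒳 : ContDiff ℝ (⊤ : ℕ∞) 𝒳)
    (h𝒳1 : ∀ t : ℝ, |t| ≤ c → 𝒳 t = 1)
    (h𝒳0 : ∀ t : ℝ, (c + ct) / 2 ≤ |t| → 𝒳 t = 0)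
    (j : ℤ × ℤ)
    (hj1 : betaCoef k α j.1 ≠ (j.2 : ℂ) * (π : ℂ) / (ct : ℂ))
    (hj2 : betaCoef k α j.1 ≠ -((j.2 : ℂ) * (π : ℂ) / (ct : ℂ))) :
    fourierCoef ct (funK k α 𝒳) j =
      ((1 : ℂ) / (2 * (Real.sqrt (π * ct) : ℂ))) *
        ((1 : ℂ) / (((α + (j.1 : ℝ)) ^ 2 + ((j.2 : ℝ) * π / ct) ^ 2 - k ^ 2 : ℝ) : ℂ) +
          (1 / (2 * betaCoef k α j.1 * ((j.2 : ℂ) * (π : ℂ) / (ct : ℂ) - betaCoef k α j.1))) *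
            (∫ t in (0 : ℝ)..ct,
              Complex.exp (Complex.I * betaCoef k α j.1 * (t : ℂ)) * ((deriv 𝒳 t : ℝ) : ℂ) *
                Complex.exp (-Complex.I * ((j.2 : ℂ) * (π : ℂ) / (ct : ℂ)) * (t : ℂ))) -
          (1 / (2 * betaCoef k α j.1 * ((j.2 : ℂ) * (π : ℂ) / (ct : ℂ) + betaCoef k α j.1))) *
            (∫ t in (0 : ℝ)..ct,
              Complex.exp (Complex.I * betaCoef k α j.1 * (t : ℂ)) * ((deriv 𝒳 t : ℝ) : ℂ) *
                Complex.exp (Complex.I * ((j.2 : ℂ) * (π : ℂ) / (ct : ℂ)) * (t : ℂ)))) := by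
  have hct : 0 < ct := hc.trans hcct
  have h𝒳' : ContDiff ℝ 1 𝒳 := h𝒳.of_le (by exact_mod_cast le_top)
  have h0 : 𝒳 0 = 1 := h𝒳1 0 (by simpa using hc.le)
  have h1 : 𝒳 ct = 0 := h𝒳0 ct (by rw [abs_of_pos hct]; linarith)
  have hb := hβ j.1
  have hsq := betaCoef_sq hk.le α j.1
  rw [fourierCoef_funK hk α hct.le h𝒳.continuous, integral_modeFactor hct.le k α h𝒳.continuous]
  have hden : (((α + (j.1 : ℝ)) ^ 2 + ((j.2 : ℝ) * π / ct) ^ 2 - k ^ 2 : ℝ) : ℂ) =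
      ((j.2 : ℂ) * π / ct - betaCoef k α j.1) * ((j.2 : ℂ) * π / ct + betaCoef k α j.1) := by
    push_cast at hsq ⊢
    linear_combination hsq
  have hqcast : (((j.2 : ℝ) * π / ct : ℝ) : ℂ) = (j.2 : ℂ) * π / ct := by push_cast; rfl
  rw [hden, hqcast]
  generalize (j.2 : ℂ) * π / ct = q at *
  generalize betaCoef k α j.1 = b at *
  have hm : b - q ≠ 0 := sub_ne_zero.mpr hj1
  have hp : b + q ≠ 0 := fun h => hj2 (eq_neg_of_add_eq_zero_left h)
  have hm' : q - b ≠ 0 := sub_ne_zero.mpr hj1.symm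
  have hp' : q + b ≠ 0 := by rwa [add_comm]
  have hs : (Real.sqrt (π * ct) : ℂ) ≠ 0 :=
    ofReal_ne_zero.mpr (Real.sqrt_pos.mpr (mul_pos pi_pos hct)).ne'
  rw [integral_exp_mul_cutoff h𝒳' h0 h1 hm, integral_exp_mul_cutoff h𝒳' h0 h1 hp]
  have hIm : ∫ t in (0 : ℝ)..ct, Complex.exp (I * b * t) * ((deriv 𝒳 t : ℝ) : ℂ) *
      Complex.exp (-I * q * t) =
      ∫ t in (0 : ℝ)..ct, Complex.exp (I * (b - q) * t) * ((deriv 𝒳 t : ℝ) : ℂ) := by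
    congr 1 with t
    rw [mul_right_comm, ← Complex.exp_add]
    ring_nf
  have hIp : ∫ t in (0 : ℝ)..ct, Complex.exp (I * b * t) * ((deriv 𝒳 t : ℝ) : ℂ) *
      Complex.exp (I * q * t) =
      ∫ t in (0 : ℝ)..ct, Complex.exp (I * (b + q) * t) * ((deriv 𝒳 t : ℝ) : ℂ) := by
    congr 1 with t
    rw [mul_right_comm, ← Complex.exp_add]
    ring_nf
  rw [hIm, hIp]
  generalize (∫ t in (0 : ℝ)..ct, Complex.exp (I * (b - q) * t) * ((deriv 𝒳 t : ℝ) : ℂ)) = A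
  generalize (∫ t in (0 : ℝ)..ct, Complex.exp (I * (b + q) * t) * ((deriv 𝒳 t : ℝ) : ℂ)) = B
  rw [← neg_sub q b, add_comm b q]
  field_simp
  rw [I_sq]
  ring

end
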